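/- arXiv:2511.20843 — 7 statements merged into one kernel-verified Lean document; each statement's English description precedes it below -/
import Mathlib

section
/- For every natural number n, the Legendre polynomial P_n has degree n, and P_n has exactly n real roots, all of which are simple and lie in the open interval (−1, 1). -/
open Polynomial

/-- The Legendre polynomial `P n`, defined via the Rodrigues formula
`P_n(t) = (1/(2^n n!)) dⁿ/dtⁿ [(t² − 1)ⁿ]`. -/
noncomputable def legendre (n : ℕ) : Polynomial ℝ :=
  C (1 / (2 ^ n * (n.factorial : ℝ))) * derivative^[n] ((X ^ 2 - 1) ^ n)

/-- Iterating the derivative `k` times lowers the degree by exactly `k` in characteristic zero. -/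
theorem natDegree_iterate_derivative_eq (p : ℝ[X]) (k : ℕ) :
    (derivative^[k] p).natDegree = p.natDegree - k := by
  induction k with
  | zero => simp
  | succ k ih => rw [Function.iterate_succ_apply', natDegree_derivative, ih, Nat.sub_sub]

theorem natDegree_X_sq_sub_one_pow (n : ℕ) :
    ((X ^ 2 - 1 : ℝ[X]) ^ n).natDegree = 2 * n := by
  have h : (X ^ 2 - 1 : ℝ[X]).natDegree = 2 := by compute_degree!
  rw [natDegree_pow, h, mul_comm]

theorem natDegree_iterate_derivative_X_sq_sub_one_pow (n k : ℕ) :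
    (derivative^[k] ((X ^ 2 - 1 : ℝ[X]) ^ n)).natDegree = 2 * n - k := by
  rw [natDegree_iterate_derivative_eq, natDegree_X_sq_sub_one_pow]

theorem iterate_derivative_X_sq_sub_one_pow_ne_zero {n k : ℕ} (hk : k ≤ n) :
    derivative^[k] ((X ^ 2 - 1 : ℝ[X]) ^ n) ≠ 0 := by
  rcases Nat.eq_zero_or_pos n with rfl | hn
  · obtain rfl : k = 0 := by omega
    simp
  · apply ne_zero_of_natDegree_gt (n := 0)
    rw [natDegree_iterate_derivative_X_sq_sub_one_pow]
    omega

/-- The derivatives of `(X² - 1)ⁿ` of order less than `n` vanish at the roots of `X² - 1`. -/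
theorem isRoot_iterate_derivative_X_sq_sub_one_pow {n k : ℕ} (hk : k < n) {x : ℝ}
    (hx : x ^ 2 = 1) : (derivative^[k] ((X ^ 2 - 1 : ℝ[X]) ^ n)).IsRoot x := by
  have h : (X ^ 2 - 1 : ℝ[X]) ∣ derivative^[k] ((X ^ 2 - 1 : ℝ[X]) ^ n) :=
    (dvd_pow_self _ (Nat.sub_ne_zero_of_lt hk)).trans (pow_sub_dvd_iterate_derivative_pow _ n k)
  refine IsRoot.dvd ?_ h
  simp [hx]

/-- The `k`-th derivative of `(X² - 1)ⁿ` has at least `k` distinct roots in `(-1, 1)`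
for `k ≤ n`, by Rolle's theorem. -/
theorem exists_roots_iterate_derivative_X_sq_sub_one_pow {n k : ℕ} (hk : k ≤ n) :
    ∃ S : Finset ℝ, S.card = k ∧ ∀ t ∈ S, t ∈ Set.Ioo (-1 : ℝ) 1 ∧
      (derivative^[k] ((X ^ 2 - 1 : ℝ[X]) ^ n)).IsRoot t := by
  induction k with
  | zero => exact ⟨∅, by simp⟩
  | succ k ih =>
    obtain ⟨S, hcard, hS⟩ := ih (by omega)
    set p := derivative^[k] ((X ^ 2 - 1 : ℝ[X]) ^ n)
    have hp' : derivative p ≠ 0 := by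
      rw [← Function.iterate_succ_apply' derivative k]
      exact iterate_derivative_X_sq_sub_one_pow_ne_zero hk
    let A : Finset ℝ := insert (-1) (insert 1 S)
    have hA : ∀ t ∈ A, t ∈ Set.Icc (-1 : ℝ) 1 ∧ p.IsRoot t := by
      intro t ht
      simp only [A, Finset.mem_insert] at ht
      rcases ht with rfl | rfl | ht
      · exact ⟨by simp, isRoot_iterate_derivative_X_sq_sub_one_pow hk (by norm_num)⟩
      · exact ⟨by simp, isRoot_iterate_derivative_X_sq_sub_one_pow hk (by norm_num)⟩
      · exact ⟨Set.Ioo_subset_Icc_self (hS t ht).1, (hS t ht).2⟩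
    have hAcard : A.card = k + 2 := by
      have h1 : (1 : ℝ) ∉ S := fun h => lt_irrefl _ (hS 1 h).1.2
      have h2 : (-1 : ℝ) ∉ insert 1 S := by
        rw [Finset.mem_insert, not_or]
        exact ⟨by norm_num, fun h => lt_irrefl _ (hS (-1) h).1.1⟩
      rw [Finset.card_insert_of_notMem h2, Finset.card_insert_of_notMem h1, hcard]
    let T : Finset ℝ := {t ∈ (derivative p).roots.toFinset | t ∈ Set.Ioo (-1 : ℝ) 1}
    have hAT : A.card ≤ T.card + 1 := by
      refine Finset.card_le_of_interleaved fun x hx y hy hxy _ => ?_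
      obtain ⟨z, hz1, hz2⟩ :=
        exists_deriv_eq_zero hxy p.continuousOn ((hA x hx).2.trans (hA y hy).2.symm)
      refine ⟨z, ?_, hz1⟩
      rw [Finset.mem_filter, Multiset.mem_toFinset, mem_roots hp', IsRoot, ← p.deriv]
      exact ⟨hz2, (hA x hx).1.1.trans_lt hz1.1, hz1.2.trans_le (hA y hy).1.2⟩
    obtain ⟨S', hS'T, hS'⟩ := Finset.exists_subset_card_eq (show k + 1 ≤ T.card by omega)
    refine ⟨S', hS', fun t ht => ?_⟩
    have htT := hS'T ht
    rw [Finset.mem_filter, Multiset.mem_toFinset, mem_roots hp'] at htT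
    rw [Function.iterate_succ_apply']
    exact ⟨htT.2, htT.1⟩

/-- For every natural number `n`, the Legendre polynomial `P_n` has degree `n`, and it has
exactly `n` real roots, all of which are simple and lie in the open interval `(−1, 1)`. -/
theorem legendre_degree_and_roots (n : ℕ) :
    (legendre n).degree = n ∧
    ∃ S : Finset ℝ, S.card = n ∧ (∀ t ∈ S, t ∈ Set.Ioo (-1 : ℝ) 1) ∧
      (legendre n).roots = S.val := by
  have hc : (1 / (2 ^ n * (n.factorial : ℝ))) ≠ 0 := by positivity
  have h0 := iterate_derivative_X_sq_sub_one_pow_ne_zero (le_refl n)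
  have hdeg : (derivative^[n] ((X ^ 2 - 1 : ℝ[X]) ^ n)).natDegree = n := by
    rw [natDegree_iterate_derivative_X_sq_sub_one_pow]
    omega
  refine ⟨?_, ?_⟩
  · rw [legendre, degree_C_mul hc, degree_eq_natDegree h0, hdeg]
  · obtain ⟨S, hcard, hS⟩ := exists_roots_iterate_derivative_X_sq_sub_one_pow (le_refl n)
    refine ⟨S, hcard, fun t ht => (hS t ht).1, ?_⟩
    rw [legendre, roots_C_mul _ hc]
    refine (Multiset.eq_of_le_of_card_le ?_ ?_).symm
    · exact (Multiset.le_iff_subset S.nodup).2 fun t ht => (mem_roots h0).2 (hS t ht).2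
    · exact (card_roots' _).trans (by rw [hdeg, Finset.card_val, hcard])
end

section
/- Let N ∈ ℕ and let t_0, …, t_N be the N + 1 roots of the Legendre polynomial P_{N+1} (which are pairwise distinct and lie in (−1, 1)). Then every quadrature weight w_j = ∫_{−1}^{1} φ_j(t) dt, where φ_j is the j-th Lagrange basis polynomial for these nodes, is strictly positive. (This is the Gauss-grid case of the proposition that Gaussian grids with uniform weight function W ≡ 1 yield positive integration weights.) -/
open Polynomial

theorem integral_iterate_derivative_mul_eq_zero (n k : ℕ) (hk : k ≤ n) (r : ℝ[X])
    (hr : r.degree < k) :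
    ∫ s in (-1 : ℝ)..1, (derivative^[k] ((X ^ 2 - 1) ^ n : ℝ[X])).eval s * r.eval s = 0 := by
  induction k generalizing r with
  | zero =>
    have : r = 0 := degree_eq_bot.1 (by simpa using hr)
    simp [this]
  | succ k ih =>
    have hdvd : (X ^ 2 - 1 : ℝ[X]) ∣ derivative^[k] ((X ^ 2 - 1) ^ n) :=
      (dvd_pow_self _ (by lia)).trans (pow_sub_dvd_iterate_derivative_pow _ n k)
    have hbdry (x : ℝ) (hx : x ^ 2 = 1) :
        (derivative^[k] ((X ^ 2 - 1) ^ n : ℝ[X])).eval x = 0 :=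
      eval_eq_zero_of_dvd_of_eval_eq_zero hdvd (by simp [hx])
    have hr' : r.derivative.degree < k := by
      rcases eq_or_ne r 0 with rfl | h0
      · simp
      · refine (degree_derivative_lt h0).trans_le ?_
        rw [degree_eq_natDegree h0] at hr ⊢
        norm_cast at hr ⊢
        lia
    simp_rw [mul_comm _ (r.eval _), Function.iterate_succ_apply']
    rw [intervalIntegral.integral_mul_deriv_eq_deriv_mul
      (fun x _ => r.hasDerivAt x) (fun x _ => Polynomial.hasDerivAt _ x)
      ((Polynomial.continuous _).intervalIntegrable _ _)
      ((Polynomial.continuous _).intervalIntegrable _ _)]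
    rw [hbdry 1 (by norm_num), hbdry (-1) (by norm_num)]
    simpa [mul_comm] using ih (by lia) _ hr'

theorem integral_legendre_mul_eq_zero (n : ℕ) (r : ℝ[X]) (hr : r.degree < n) :
    ∫ s in (-1 : ℝ)..1, (legendre n * r).eval s = 0 := by
  simp [legendre, mul_assoc, integral_iterate_derivative_mul_eq_zero n n le_rfl r hr]

theorem degree_legendre (n : ℕ) : (legendre n).degree = n := by
  have hmonic : ((X ^ 2 - 1 : ℝ[X]) ^ n).Monic := (monic_X_pow_sub_C 1 two_ne_zero).pow n
  have hdeg : ((X ^ 2 - 1 : ℝ[X]) ^ n).natDegree = n + n := by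
    rw [natDegree_pow, ← C_1, natDegree_X_pow_sub_C]
    lia
  have hcoeff : (derivative^[n] ((X ^ 2 - 1 : ℝ[X]) ^ n)).coeff n ≠ 0 := by
    rw [coeff_iterate_derivative, ← hdeg, hmonic.coeff_natDegree, hdeg, nsmul_one]
    exact_mod_cast (Nat.descFactorial_pos.2 (by lia)).ne'
  have hle : (derivative^[n] ((X ^ 2 - 1 : ℝ[X]) ^ n)).natDegree ≤ n :=
    (natDegree_iterate_derivative _ n).trans (by lia)
  rw [legendre, degree_C_mul (by positivity)]
  exact degree_eq_of_le_of_coeff_ne_zero (natDegree_le_iff_degree_le.1 hle) hcoeff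

theorem legendre_ne_zero (n : ℕ) : legendre n ≠ 0 := by
  rw [← degree_ne_bot, degree_legendre]
  exact WithBot.natCast_ne_bot n

theorem legendre_dvd_of_eval_eq_zero {n : ℕ} {t : Fin n → ℝ} (hinj : Function.Injective t)
    (hroot : ∀ j, (legendre n).eval (t j) = 0) {f : ℝ[X]} (hf : ∀ j, f.eval (t j) = 0) :
    legendre n ∣ f := by
  rw [← EuclideanDomain.mod_eq_zero]
  refine eq_zero_of_degree_lt_of_eval_index_eq_zero Finset.univ hinj.injOn ?_ ?_
  · simpa [degree_legendre] using degree_mod_lt f (legendre_ne_zero n)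
  · intro j _
    have h := congrArg (eval (t j)) (EuclideanDomain.div_add_mod f (legendre n))
    simpa [hroot, hf] using h

theorem integral_sq_eval_pos {p : ℝ[X]} (hp : p ≠ 0) {a b : ℝ} (hab : a < b) :
    0 < ∫ s in a..b, p.eval s ^ 2 := by
  obtain ⟨c, hc, hpc⟩ := (Set.Icc_infinite hab).exists_notMem_finset p.roots.toFinset
  refine intervalIntegral.integral_pos hab (by fun_prop) (fun _ _ => sq_nonneg _) ⟨c, hc, ?_⟩
  have : p.eval c ≠ 0 := by simpa [hp] using hpc
  positivity

/-- Let `t 0, …, t N` be the `N + 1` roots of the Legendre polynomial `P_{N+1}` (pairwise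
distinct and lying in `(−1, 1)`).  Then every quadrature weight
`w j = ∫_{−1}^{1} φ_j(t) dt`, where `φ_j` is the `j`-th Lagrange basis polynomial for these
nodes, is strictly positive. -/
theorem gauss_weights_pos (N : ℕ) (t : Fin (N + 1) → ℝ)
    (hinj : Function.Injective t)
    (hmem : ∀ j, t j ∈ Set.Ioo (-1 : ℝ) 1)
    (hroot : ∀ j, (legendre (N + 1)).eval (t j) = 0) :
    ∀ j : Fin (N + 1),
      0 < ∫ s in (-1 : ℝ)..1, (Lagrange.basis Finset.univ t j).eval s := by
  intro j
  set p := Lagrange.basis Finset.univ t j with hp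
  have hp0 : p ≠ 0 := Lagrange.basis_ne_zero hinj.injOn (Finset.mem_univ j)
  have hpdeg : p.natDegree = N := by
    simp [hp, Lagrange.natDegree_basis hinj.injOn (Finset.mem_univ j)]
  obtain ⟨r, hr⟩ : legendre (N + 1) ∣ p ^ 2 - p := by
    refine legendre_dvd_of_eval_eq_zero hinj hroot fun k => ?_
    rcases eq_or_ne j k with rfl | hjk
    · simp [hp, Lagrange.eval_basis_self hinj.injOn (Finset.mem_univ j)]
    · simp [hp, Lagrange.eval_basis_of_ne hjk (Finset.mem_univ k)]
  have hrdeg : r.degree < (N + 1 : ℕ) := by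
    rcases eq_or_ne r 0 with rfl | hr0
    · simp
    have hle : (p ^ 2 - p).natDegree ≤ 2 * N :=
      natDegree_sub_le_of_le (natDegree_pow_le_of_le 2 hpdeg.le) (by lia : p.natDegree ≤ 2 * N)
        |>.trans (by simp)
    rw [hr, natDegree_mul (legendre_ne_zero _) hr0, natDegree_eq_of_degree_eq_some (degree_legendre _)] at hle
    rw [← natDegree_lt_iff_degree_lt hr0]
    lia
  have hint : ∫ s in (-1 : ℝ)..1, (p.eval s ^ 2 - p.eval s) = 0 := by
    simpa [← hr] using integral_legendre_mul_eq_zero (N + 1) r hrdeg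
  rw [intervalIntegral.integral_sub
    (Continuous.intervalIntegrable (by fun_prop) _ _)
    (Continuous.intervalIntegrable (by fun_prop) _ _)] at hint
  linarith [integral_sq_eval_pos hp0 (show (-1 : ℝ) < 1 by norm_num)]
end

section
/- Let N ≥ 1 and let t_0, …, t_N be the Legendre–Gauss–Lobatto nodes of order N, i.e. the N + 1 distinct roots of (1 − t²) · P_N′(t). Then every quadrature weight w_j = ∫_{−1}^{1} φ_j(t) dt, where φ_j is the j-th Lagrange basis polynomial for these nodes, is strictly positive. (This is the Gauss–Lobatto-grid case of the proposition that Gaussian grids with uniform weight function W ≡ 1 yield positive integration weights.) -/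
open Polynomial

/-- Integration by parts for real polynomials when the boundary terms vanish. -/
theorem integral_derivative_mul_eval_eq_neg {p q : ℝ[X]} {a b : ℝ}
    (ha : (p * q).eval a = 0) (hb : (p * q).eval b = 0) :
    ∫ s in a..b, (derivative p * q).eval s = -∫ s in a..b, (p * derivative q).eval s := by
  have hint (r : ℝ[X]) : IntervalIntegrable (fun s => r.eval s) MeasureTheory.volume a b :=
    r.continuous.intervalIntegrable a b
  have hftc : ∫ s in a..b, (derivative (p * q)).eval s = (p * q).eval b - (p * q).eval a :=
    intervalIntegral.integral_eq_sub_of_hasDerivAt (fun x _ => (p * q).hasDerivAt x) (hint _)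
  rw [ha, hb, sub_self, derivative_mul] at hftc
  simp only [eval_add] at hftc
  rw [intervalIntegral.integral_add (hint _) (hint _)] at hftc
  linarith

theorem eval_iterate_derivative_X_sq_sub_one_pow {m n : ℕ} (hmn : m < n) {a : ℝ}
    (ha : a ^ 2 = 1) : (derivative^[m] ((X ^ 2 - 1 : ℝ[X]) ^ n)).eval a = 0 := by
  have hdvd : (X - C a) ∣ (X ^ 2 - 1 : ℝ[X]) := by
    rw [dvd_iff_isRoot]; simp [ha]
  have h := pow_sub_dvd_iterate_derivative_of_pow_dvd m (pow_dvd_pow_of_dvd hdvd n)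
  exact dvd_iff_isRoot.mp ((dvd_pow_self _ (Nat.sub_ne_zero_of_lt hmn)).trans h)

theorem integral_iterate_derivative_X_sq_sub_one_pow_mul {m n : ℕ} (hmn : m ≤ n) {r : ℝ[X]}
    (hr : derivative^[m] r = 0) :
    ∫ s in (-1 : ℝ)..1, (derivative^[m] ((X ^ 2 - 1 : ℝ[X]) ^ n) * r).eval s = 0 := by
  induction m generalizing r with
  | zero => simp_all
  | succ m ih =>
    rw [Function.iterate_succ_apply',
      integral_derivative_mul_eval_eq_neg
        (by rw [eval_mul, eval_iterate_derivative_X_sq_sub_one_pow hmn (by norm_num), zero_mul])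
        (by rw [eval_mul, eval_iterate_derivative_X_sq_sub_one_pow hmn (by norm_num), zero_mul]),
      ih (by omega) (by rwa [Function.iterate_succ_apply] at hr), neg_zero]

/-- `(1 - X²) P_n'` is orthogonal on `[-1, 1]` to the polynomials of degree at most `n - 2`. -/
theorem integral_one_sub_X_sq_mul_derivative_legendre_mul {n : ℕ} {k : ℝ[X]}
    (hk : ((1 - X ^ 2) * k).natDegree ≤ n) :
    ∫ s in (-1 : ℝ)..1, ((1 - X ^ 2) * derivative (legendre n) * k).eval s = 0 := by
  have hcomm : (1 - X ^ 2) * derivative (legendre n) * k =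
      derivative (legendre n) * ((1 - X ^ 2) * k) := by ring
  rw [hcomm, integral_derivative_mul_eval_eq_neg (by simp) (by simp), neg_eq_zero]
  simp only [legendre, mul_assoc, eval_C_mul]
  rw [intervalIntegral.integral_const_mul,
    integral_iterate_derivative_X_sq_sub_one_pow_mul le_rfl, mul_zero]
  rw [← Function.iterate_succ_apply]
  exact iterate_derivative_eq_zero (Nat.lt_succ_of_le hk)

theorem natDegree_derivative_legendre_le (n : ℕ) :
    (derivative (legendre n)).natDegree ≤ n - 1 := by
  refine (natDegree_derivative_le _).trans (Nat.sub_le_sub_right ?_ 1)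
  refine (natDegree_C_mul_le _ _).trans ((natDegree_iterate_derivative _ _).trans ?_)
  rw [natDegree_X_sq_sub_one_pow]
  omega

theorem derivative_legendre_ne_zero {n : ℕ} (hn : 1 ≤ n) : derivative (legendre n) ≠ 0 := by
  rw [legendre, derivative_C_mul, ← Function.iterate_succ_apply' derivative]
  refine mul_ne_zero (by simp [Nat.factorial_ne_zero]) fun h => ?_
  have hcoeff := congrArg (fun p : ℝ[X] => p.coeff (n - 1)) h
  have hmonic : ((X ^ 2 - 1 : ℝ[X]) ^ n).Monic :=
    (show (X ^ 2 - 1 : ℝ[X]) = X ^ 2 - C 1 by simp) ▸ (monic_X_pow_sub_C 1 two_ne_zero).pow n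
  have hlead := hmonic.coeff_natDegree
  rw [natDegree_X_sq_sub_one_pow] at hlead
  simp only [coeff_iterate_derivative, show n - 1 + n.succ = 2 * n by omega, hlead, coeff_zero,
    nsmul_eq_mul, mul_one, Nat.cast_eq_zero, Nat.descFactorial_eq_zero_iff_lt] at hcoeff
  omega

/-- If a nonzero `Q` of degree at most the number of nodes vanishes at all of them, then
`(X - t j) φ_j` is a scalar multiple of `Q`. -/
theorem exists_X_sub_C_mul_lagrange_basis_eq {N : ℕ} {t : Fin (N + 1) → ℝ}
    (hinj : Function.Injective t) {Q : ℝ[X]} (hQ : Q ≠ 0) (hdeg : Q.natDegree ≤ N + 1)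
    (hroot : ∀ j, Q.eval (t j) = 0) (j : Fin (N + 1)) :
    ∃ b : ℝ, (X - C (t j)) * Lagrange.basis Finset.univ t j = C b * Q := by
  obtain ⟨c, hc⟩ : Lagrange.nodal Finset.univ t ∣ Q :=
    Finset.prod_dvd_of_coprime
      (fun i _ k _ hik => isCoprime_X_sub_C_of_isUnit_sub (sub_ne_zero.mpr (hinj.ne hik)).isUnit)
      (fun i _ => dvd_iff_isRoot.mpr (hroot i))
  have hc0 : c ≠ 0 := by rintro rfl; simp_all
  have hcdeg : c.natDegree = 0 := by
    have h := congrArg natDegree hc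
    rw [natDegree_mul Lagrange.nodal_ne_zero hc0, Lagrange.natDegree_nodal, Finset.card_univ,
      Fintype.card_fin] at h
    omega
  obtain ⟨a, rfl⟩ := natDegree_eq_zero.mp hcdeg
  have ha : a ≠ 0 := by rintro rfl; simp at hc0
  refine ⟨Lagrange.nodalWeight Finset.univ t j * a⁻¹, ?_⟩
  have hbasis : (X - C (t j)) * Lagrange.basis Finset.univ t j =
      C (Lagrange.nodalWeight Finset.univ t j) * Lagrange.nodal Finset.univ t := by
    rw [Lagrange.basis_eq_prod_sub_inv_mul_nodal_div (Finset.mem_univ j), mul_left_comm,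
      ← Lagrange.nodal_erase_eq_nodal_div (Finset.mem_univ j),
      ← Lagrange.nodal_eq_mul_nodal_erase (Finset.mem_univ j)]
  rw [hbasis, hc, C_mul, show C (Lagrange.nodalWeight Finset.univ t j) * C a⁻¹ *
      (Lagrange.nodal Finset.univ t * C a) = C (Lagrange.nodalWeight Finset.univ t j) *
      Lagrange.nodal Finset.univ t * (C a⁻¹ * C a) by ring, ← C_mul, inv_mul_cancel₀ ha, C_1,
    mul_one]

/-- If `(X - x) φ` is a multiple of `(1 - X²) P_n'`, then the functional `g ↦ ∫ φ g` acts on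
polynomials of degree less than `n` as a multiple of evaluation at `x`. -/
theorem integral_mul_eq_eval_mul_integral {n : ℕ} (hn : 1 ≤ n) {φ g : ℝ[X]} {x b : ℝ}
    (hφ : (X - C x) * φ = C b * ((1 - X ^ 2) * derivative (legendre n)))
    (hg : g.natDegree ≤ n - 1) :
    ∫ s in (-1 : ℝ)..1, (φ * g).eval s = g.eval x * ∫ s in (-1 : ℝ)..1, φ.eval s := by
  have hroot : (g - C (g.eval x)).IsRoot x := by simp
  obtain ⟨k, hk⟩ := dvd_iff_isRoot.mpr hroot
  have hsplit : φ * g =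
      C b * ((1 - X ^ 2) * derivative (legendre n) * k) + C (g.eval x) * φ := by
    linear_combination φ * hk + k * hφ
  have hkdeg : ((1 - X ^ 2) * k).natDegree ≤ n := by
    by_cases hk0 : k = 0
    · simp [hk0]
    have h := congrArg natDegree hk
    rw [natDegree_sub_C, natDegree_mul (X_sub_C_ne_zero x) hk0, natDegree_X_sub_C] at h
    have h2 : (1 - X ^ 2 : ℝ[X]).natDegree ≤ 2 := by compute_degree
    have := natDegree_mul_le (p := (1 - X ^ 2 : ℝ[X])) (q := k)
    omega
  simp only [hsplit, eval_add, eval_C_mul]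
  rw [intervalIntegral.integral_add, intervalIntegral.integral_const_mul,
    intervalIntegral.integral_const_mul,
    integral_one_sub_X_sq_mul_derivative_legendre_mul hkdeg, mul_zero, zero_add]
  all_goals exact (continuous_const.mul (Polynomial.continuous _)).intervalIntegrable _ _

theorem integral_mul_sq_eval_pos {A B : ℝ[X]} (hB : B ≠ 0)
    (hA : ∀ s ∈ Set.Ioo (-1 : ℝ) 1, 0 < A.eval s) :
    0 < ∫ s in (-1 : ℝ)..1, (A * B ^ 2).eval s := by
  obtain ⟨x, hx, hxB⟩ : ∃ x ∈ Set.Ioo (-1 : ℝ) 1, B.eval x ≠ 0 := by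
    by_contra! h
    exact hB (eq_zero_of_infinite_isRoot B
      ((Set.Ioo_infinite (by norm_num : (-1 : ℝ) < 1)).mono h))
  have hclosed : ∀ s ∈ Set.Icc (-1 : ℝ) 1, 0 ≤ A.eval s := by
    rw [← closure_Ioo (by norm_num : (-1 : ℝ) ≠ 1)]
    exact fun s hs => closure_minimal (fun u hu => (hA u hu).le)
      (isClosed_Ici.preimage A.continuous) hs
  refine intervalIntegral.integral_pos (by norm_num) (Polynomial.continuous _).continuousOn
    (fun s hs => ?_) ⟨x, Set.Ioo_subset_Icc_self hx, ?_⟩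
  · rw [eval_mul, eval_pow]
    exact mul_nonneg (hclosed s (Set.Ioc_subset_Icc_self hs)) (sq_nonneg _)
  · rw [eval_mul, eval_pow]
    exact mul_pos (hA x hx) (by positivity)

/-- A basis polynomial `φ = A * B` for the Lobatto grid has positive integral as soon as `A` is
positive on `(-1, 1)` and at the node, and `B` has degree less than `n`. -/
theorem integral_eval_pos_of_eq_mul {n : ℕ} (hn : 1 ≤ n) {φ A B : ℝ[X]} {x b : ℝ}
    (hφ : (X - C x) * φ = C b * ((1 - X ^ 2) * derivative (legendre n)))
    (hone : φ.eval x = 1) (hAB : φ = A * B) (hB : B.natDegree ≤ n - 1)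
    (hA : ∀ s ∈ Set.Ioo (-1 : ℝ) 1, 0 < A.eval s) (hx : 0 < A.eval x) :
    0 < ∫ s in (-1 : ℝ)..1, φ.eval s := by
  have hABx : A.eval x * B.eval x = 1 := by rw [← eval_mul, ← hAB, hone]
  have hBx : 0 < B.eval x := pos_of_mul_pos_right (hABx ▸ one_pos) hx.le
  have hB0 : B ≠ 0 := by rintro rfl; simp at hBx
  have hpos := integral_mul_sq_eval_pos hB0 hA
  rw [show A * B ^ 2 = φ * B by rw [hAB]; ring,
    integral_mul_eq_eval_mul_integral hn hφ hB] at hpos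
  exact pos_of_mul_pos_right hpos hBx.le

/-- Let `N ≥ 1` and let `t 0, …, t N` be the Legendre–Gauss–Lobatto nodes of order `N`,
i.e. the `N + 1` distinct roots of `(1 − t²)·P_N′(t)`.  Then every quadrature weight
`w j = ∫_{−1}^{1} φ_j(t) dt`, where `φ_j` is the `j`-th Lagrange basis polynomial for these
nodes, is strictly positive. -/
theorem lgl_weights_pos (N : ℕ) (hN : 1 ≤ N) (t : Fin (N + 1) → ℝ)
    (hinj : Function.Injective t)
    (hmem : ∀ j, t j ∈ Set.Icc (-1 : ℝ) 1)
    (hroot : ∀ j, ((1 - X ^ 2) * derivative (legendre N)).eval (t j) = 0) :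
    ∀ j : Fin (N + 1),
      0 < ∫ s in (-1 : ℝ)..1, (Lagrange.basis Finset.univ t j).eval s := by
  intro j
  have hD := derivative_legendre_ne_zero hN
  have hDdeg := natDegree_derivative_legendre_le N
  have hX : (1 - X ^ 2 : ℝ[X]) ≠ 0 := fun h => by
    simpa using congrArg (eval 0) h
  have hXdeg : (1 - X ^ 2 : ℝ[X]).natDegree ≤ 2 := by compute_degree
  have hQdeg : ((1 - X ^ 2) * derivative (legendre N)).natDegree ≤ N + 1 := by
    have := natDegree_mul_le (p := (1 - X ^ 2 : ℝ[X])) (q := derivative (legendre N))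
    omega
  obtain ⟨b, hb⟩ :=
    exists_X_sub_C_mul_lagrange_basis_eq hinj (mul_ne_zero hX hD) hQdeg hroot j
  have hone : (Lagrange.basis Finset.univ t j).eval (t j) = 1 :=
    Lagrange.eval_basis_self hinj.injOn (Finset.mem_univ j)
  by_cases h1 : t j = 1
  · refine integral_eval_pos_of_eq_mul hN hb hone (A := X + 1)
      (B := C (-b) * derivative (legendre N))
      (mul_left_cancel₀ (X_sub_C_ne_zero (t j)) ?_)
      ((natDegree_C_mul_le _ _).trans hDdeg) (fun s hs => ?_) ?_
    · rw [hb, h1, C_neg, C_1]; ring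
    · simp only [eval_add, eval_X, eval_one]; linarith [hs.1]
    · simp [h1]
  by_cases h2 : t j = -1
  · refine integral_eval_pos_of_eq_mul hN hb hone (A := 1 - X)
      (B := C b * derivative (legendre N))
      (mul_left_cancel₀ (X_sub_C_ne_zero (t j)) ?_)
      ((natDegree_C_mul_le _ _).trans hDdeg) (fun s hs => ?_) ?_
    · rw [hb, h2, C_neg, C_1]; ring
    · simp only [eval_sub, eval_X, eval_one]; linarith [hs.2]
    · simp [h2]
  have hsq (s : ℝ) (hs : s ∈ Set.Ioo (-1 : ℝ) 1) : 0 < (1 - X ^ 2 : ℝ[X]).eval s := by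
    simp only [eval_sub, eval_pow, eval_X, eval_one]
    nlinarith [hs.1, hs.2]
  have hmem_Ioo : t j ∈ Set.Ioo (-1 : ℝ) 1 :=
    ⟨lt_of_le_of_ne (hmem j).1 (Ne.symm h2), lt_of_le_of_ne (hmem j).2 h1⟩
  have hDroot : (derivative (legendre N)).IsRoot (t j) := by
    have h := hroot j
    rw [eval_mul] at h
    exact (mul_eq_zero.mp h).resolve_left (hsq _ hmem_Ioo).ne'
  obtain ⟨E, hE⟩ := dvd_iff_isRoot.mpr hDroot
  have hEdeg : E.natDegree ≤ N - 1 :=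
    (natDegree_le_of_dvd (Dvd.intro_left _ hE.symm) hD).trans hDdeg
  refine integral_eval_pos_of_eq_mul hN hb hone (A := 1 - X ^ 2) (B := C b * E)
      (mul_left_cancel₀ (X_sub_C_ne_zero (t j)) ?_)
    ((natDegree_C_mul_le _ _).trans hEdeg) hsq (hsq _ hmem_Ioo)
  rw [hb, hE]; ring
end

section
/- Let N ≥ 1, let t_0, …, t_N be the Legendre–Gauss–Lobatto nodes of order N (the N + 1 distinct roots of (1 − t²) · P_N′(t)), and let w_0, …, w_N be the associated quadrature weights. Then for every real polynomial p of degree at most 2N − 1, one has ∑_{j=0}^{N} w_j · p(t_j) = ∫_{−1}^{1} p(t) dt. -/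
open Polynomial

/-- Integration by parts on `[-1, 1]` for polynomials without boundary terms. -/
theorem integral_mul_derivative_of_dvd {q f : ℝ[X]} (hf : X ^ 2 - 1 ∣ q * f) :
    ∫ s in (-1 : ℝ)..1, (q * derivative f).eval s =
      -∫ s in (-1 : ℝ)..1, (derivative q * f).eval s := by
  obtain ⟨g, hg⟩ := hf
  have hend (x : ℝ) (hx : x ^ 2 = 1) : q.eval x * f.eval x = 0 := by
    rw [← eval_mul, hg]
    simp [hx]
  simp only [eval_mul]
  rw [intervalIntegral.integral_mul_deriv_eq_deriv_mul (u := fun s => q.eval s)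
    (u' := fun s => (derivative q).eval s) (v := fun s => f.eval s)
    (fun x _ => q.hasDerivAt x) (fun x _ => f.hasDerivAt x)
    ((derivative q).continuous.intervalIntegrable _ _)
    ((derivative f).continuous.intervalIntegrable _ _),
    hend 1 (by norm_num), hend (-1) (by norm_num), sub_zero, zero_sub]

/-- The `k`-th derivative of `(X² - 1)ⁿ`, `k ≤ n`, is orthogonal to polynomials of degree
less than `k`. -/
theorem integral_mul_iterate_derivative_eq_zero {n k : ℕ} (hk : k ≤ n) {q : ℝ[X]}
    (hq : q.degree < k) :
    ∫ s in (-1 : ℝ)..1, (q * derivative^[k] ((X ^ 2 - 1) ^ n)).eval s = 0 := by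
  induction k generalizing q with
  | zero =>
    obtain rfl : q = 0 := by simpa using hq
    simp
  | succ k ih =>
    have hdvd : (X ^ 2 - 1 : ℝ[X]) ∣ derivative^[k] ((X ^ 2 - 1) ^ n) :=
      (dvd_pow_self _ (by omega)).trans (pow_sub_dvd_iterate_derivative_pow _ n k)
    rw [Function.iterate_succ_apply', integral_mul_derivative_of_dvd (hdvd.mul_left q), ih (by omega),
      neg_zero]
    rcases eq_or_ne q 0 with rfl | h0
    · simp
    · have h := degree_derivative_lt h0
      rw [degree_eq_natDegree h0] at h hq
      have hle : q.natDegree ≤ k := Nat.lt_succ_iff.mp (by exact_mod_cast hq)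
      exact h.trans_le (by exact_mod_cast hle)

theorem integral_mul_legendre_eq_zero {n : ℕ} {q : ℝ[X]} (hq : q.degree < n) :
    ∫ s in (-1 : ℝ)..1, (q * legendre n).eval s = 0 := by
  have h := integral_mul_iterate_derivative_eq_zero le_rfl hq
  simp only [legendre, mul_left_comm q, eval_C_mul, intervalIntegral.integral_const_mul, h,
    mul_zero]

theorem natDegree_legendre (n : ℕ) : (legendre n).natDegree = n := by
  have h (k : ℕ) (p : ℝ[X]) : (derivative^[k] p).natDegree = p.natDegree - k := by
    induction k with
    | zero => simp
    | succ k ih => rw [Function.iterate_succ_apply', natDegree_derivative, ih, Nat.sub_sub]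
  have h2 : (X ^ 2 - 1 : ℝ[X]).natDegree = 2 := by compute_degree!
  rw [legendre, natDegree_C_mul (by positivity), h, natDegree_pow, h2]
  omega

theorem natDegree_one_sub_X_sq_mul_derivative_legendre {n : ℕ} (hn : 1 ≤ n) :
    ((1 - X ^ 2) * derivative (legendre n)).natDegree = n + 1 := by
  have h2 : (1 - X ^ 2 : ℝ[X]).natDegree = 2 := by compute_degree!
  have hne : derivative (legendre n) ≠ 0 := by
    rw [Ne, derivative_eq_zero, natDegree_legendre]
    omega
  rw [natDegree_mul (ne_zero_of_natDegree_gt (n := 1) (by omega)) hne, h2,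
    natDegree_derivative, natDegree_legendre]
  omega

theorem integral_mul_one_sub_X_sq_mul_derivative_legendre {n : ℕ} {q : ℝ[X]}
    (hq : q.natDegree + 2 ≤ n) :
    ∫ s in (-1 : ℝ)..1, (q * ((1 - X ^ 2) * derivative (legendre n))).eval s = 0 := by
  have h2 : (1 - X ^ 2 : ℝ[X]).natDegree ≤ 2 := by compute_degree
  have hdeg : (derivative (q * (1 - X ^ 2))).natDegree < n := by
    have h1 := natDegree_derivative_le (q * (1 - X ^ 2))
    have h3 := natDegree_mul_le (p := q) (q := 1 - X ^ 2)
    omega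
  have h := integral_mul_legendre_eq_zero (degree_le_natDegree.trans_lt (by exact_mod_cast hdeg))
  have hdvd : (X ^ 2 - 1 : ℝ[X]) ∣ q * (1 - X ^ 2) * legendre n :=
    ⟨-(q * legendre n), by ring⟩
  rw [← mul_assoc, integral_mul_derivative_of_dvd hdvd, h, neg_zero]

/-- A polynomial vanishing at distinct nodes is a multiple of the nodal polynomial. -/
theorem nodal_dvd_of_eval_eq_zero {F ι : Type*} [Field F] {s : Finset ι} {v : ι → F}
    (hv : Set.InjOn v s) {p : F[X]} (hp : ∀ i ∈ s, p.eval (v i) = 0) :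
    Lagrange.nodal s v ∣ p :=
  Finset.prod_dvd_of_coprime
    (fun _ hi _ hj hij =>
      isCoprime_X_sub_C_of_isUnit_sub (sub_ne_zero_of_ne (hv.ne hi hj hij)).isUnit)
    fun i hi => dvd_iff_isRoot.mpr (hp i hi)

/-- Let `N ≥ 1`, let `t 0, …, t N` be the Legendre–Gauss–Lobatto nodes of order `N` (the
`N + 1` distinct roots of `(1 − t²)·P_N′(t)`), and let `w 0, …, w N` be the associated
quadrature weights.  Then for every real polynomial `p` of degree at most `2N − 1`,
`∑_{j=0}^{N} w j · p(t j) = ∫_{−1}^{1} p(t) dt`. -/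
theorem lgl_quadrature_exact (N : ℕ) (hN : 1 ≤ N) (t : Fin (N + 1) → ℝ)
    (hinj : Function.Injective t)
    (hmem : ∀ j, t j ∈ Set.Icc (-1 : ℝ) 1)
    (hroot : ∀ j, ((1 - X ^ 2) * derivative (legendre N)).eval (t j) = 0)
    (w : Fin (N + 1) → ℝ)
    (hw : ∀ j, w j = ∫ s in (-1 : ℝ)..1, (Lagrange.basis Finset.univ t j).eval s) :
    ∀ p : Polynomial ℝ, p.degree ≤ (2 * N - 1 : ℕ) →
      ∑ j : Fin (N + 1), w j * p.eval (t j) = ∫ s in (-1 : ℝ)..1, p.eval s := by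
  intro p hp
  have hinj' : Set.InjOn t (Finset.univ : Finset (Fin (N + 1))) := hinj.injOn
  have hQ := natDegree_one_sub_X_sq_mul_derivative_legendre hN
  obtain ⟨g, hg⟩ := nodal_dvd_of_eval_eq_zero hinj' fun j _ => hroot j
  set L := Lagrange.interpolate Finset.univ t fun j => p.eval (t j) with hL
  obtain ⟨q, hq⟩ := nodal_dvd_of_eval_eq_zero (p := p - L) hinj' fun j hj => by
    rw [eval_sub, hL, Lagrange.eval_interpolate_at_node _ hinj' hj, sub_self]
  have hzero : ∫ s in (-1 : ℝ)..1, (p - L).eval s = 0 := by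
    rcases eq_or_ne q 0 with rfl | hq0
    · simp [hq]
    have hg0 : g ≠ 0 := by
      rintro rfl
      simp [hg] at hQ
    have hgdeg : g.natDegree = 0 := by
      rw [hg, natDegree_mul Lagrange.nodal_ne_zero hg0, Lagrange.natDegree_nodal] at hQ
      simpa using hQ
    obtain ⟨c, rfl⟩ := natDegree_eq_zero.mp hgdeg
    have hc : c ≠ 0 := by simpa using hg0
    have hLdeg : L.natDegree ≤ N :=
      natDegree_le_of_degree_le ((Lagrange.degree_interpolate_le _ hinj').trans_eq (by simp))
    have hqdeg : q.natDegree + 2 ≤ N := by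
      have h := natDegree_sub_le p L
      rw [hq, natDegree_mul Lagrange.nodal_ne_zero hq0, Lagrange.natDegree_nodal,
        Finset.card_univ, Fintype.card_fin] at h
      have := natDegree_le_of_degree_le hp
      omega
    have h := integral_mul_one_sub_X_sq_mul_derivative_legendre hqdeg
    rw [hg, mul_comm _ (C c), mul_left_comm, mul_comm q, ← hq] at h
    simpa only [eval_C_mul, intervalIntegral.integral_const_mul, mul_eq_zero, hc, false_or]
      using h
  simp only [eval_sub] at hzero
  rw [intervalIntegral.integral_sub (p.continuous.intervalIntegrable _ _)
    (L.continuous.intervalIntegrable _ _), sub_eq_zero] at hzero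
  simp only [hzero, hL, Lagrange.interpolate_apply, eval_finsetSum, eval_C_mul]
  rw [intervalIntegral.integral_finsetSum fun j _ =>
    ((Lagrange.basis Finset.univ t j).continuous.intervalIntegrable _ _).const_mul _]
  exact Finset.sum_congr rfl fun j _ => by
    rw [intervalIntegral.integral_const_mul, ← hw, mul_comm]
end

section
/- Let N ∈ ℕ, let t_0, …, t_N be the N + 1 roots of the Legendre polynomial P_{N+1}, and let w_0, …, w_N be the associated quadrature weights. Then for every real polynomial p of degree at most 2N + 1, one has ∑_{j=0}^{N} w_j · p(t_j) = ∫_{−1}^{1} p(t) dt. -/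
open Polynomial

theorem eval_iterate_derivative_sq_sub_one_pow {n k : ℕ} (hk : k < n) {a : ℝ} (ha : a ^ 2 = 1) :
    (derivative^[k] ((X ^ 2 - 1 : ℝ[X]) ^ n)).eval a = 0 := by
  have h : (X ^ 2 - 1 : ℝ[X]) ^ (n - k) ∣ derivative^[k] ((X ^ 2 - 1 : ℝ[X]) ^ n) :=
    pow_sub_dvd_iterate_derivative_of_pow_dvd k dvd_rfl
  refine eval_eq_zero_of_dvd_of_eval_eq_zero h ?_
  simp [ha, Nat.sub_ne_zero_of_lt hk]

/-- Repeated integration by parts against a polynomial of low degree. -/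
theorem integral_iterate_derivative_sq_sub_one_pow_mul {n k : ℕ} (hk : k ≤ n) {q : ℝ[X]}
    (hq : q.degree < k) :
    ∫ s in (-1 : ℝ)..1, (derivative^[k] ((X ^ 2 - 1 : ℝ[X]) ^ n)).eval s * q.eval s = 0 := by
  induction k generalizing q with
  | zero =>
    have : q = 0 := by simpa [Nat.WithBot.lt_zero_iff] using hq
    simp [this]
  | succ k ih =>
    have hq' : (derivative q).degree < k := by
      rcases eq_or_ne q 0 with rfl | h0
      · simp [bot_lt_iff_ne_bot]
      · have h : q.natDegree < k + 1 := (natDegree_lt_iff_degree_lt h0).2 hq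
        exact (degree_derivative_lt h0).trans_le (degree_le_of_natDegree_le (by omega))
    rw [Function.iterate_succ_apply']
    simp only [mul_comm _ (q.eval _)]
    rw [intervalIntegral.integral_mul_deriv_eq_deriv_mul (fun x _ => q.hasDerivAt x)
      (fun x _ => Polynomial.hasDerivAt _ x) (Continuous.intervalIntegrable (by fun_prop) _ _)
      (Continuous.intervalIntegrable (by fun_prop) _ _),
      eval_iterate_derivative_sq_sub_one_pow hk (by norm_num),
      eval_iterate_derivative_sq_sub_one_pow hk (by norm_num)]
    simp only [mul_comm ((derivative q).eval _)]
    rw [ih (Nat.le_of_succ_le hk) hq']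
    simp

/-- `legendre n` is orthogonal on `[-1, 1]` to all polynomials of degree less than `n`. -/
theorem integral_legendre_mul {n : ℕ} {q : ℝ[X]} (hq : q.degree < n) :
    ∫ s in (-1 : ℝ)..1, (legendre n * q).eval s = 0 := by
  simp only [legendre, eval_mul, eval_C, mul_assoc, intervalIntegral.integral_const_mul]
  rw [integral_iterate_derivative_sq_sub_one_pow_mul le_rfl hq, mul_zero]

/-- The interpolatory quadrature rule on distinct nodes is exact below the number of nodes. -/
theorem sum_integral_basis_mul_eval {N : ℕ} {t : Fin N → ℝ} (hinj : Function.Injective t)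
    {r : ℝ[X]} (hr : r.degree < N) :
    ∑ j, (∫ s in (-1 : ℝ)..1, (Lagrange.basis Finset.univ t j).eval s) * r.eval (t j) =
      ∫ s in (-1 : ℝ)..1, r.eval s := by
  have h := Lagrange.eq_interpolate (s := Finset.univ) (f := r) hinj.injOn (by simpa using hr)
  conv_rhs => rw [h]
  simp only [Lagrange.interpolate_apply, eval_finsetSum, eval_mul, eval_C]
  rw [intervalIntegral.integral_finsetSum
    fun j _ => (Continuous.intervalIntegrable (by fun_prop) _ _)]
  refine Finset.sum_congr rfl fun j _ => ?_
  rw [intervalIntegral.integral_const_mul, mul_comm]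

/-- Let `N ∈ ℕ`, let `t 0, …, t N` be the `N + 1` roots of the Legendre polynomial `P_{N+1}`,
and let `w 0, …, w N` be the associated quadrature weights.  Then for every real polynomial
`p` of degree at most `2N + 1`, `∑_{j=0}^{N} w j · p(t j) = ∫_{−1}^{1} p(t) dt`. -/
theorem gauss_quadrature_exact (N : ℕ) (t : Fin (N + 1) → ℝ)
    (hinj : Function.Injective t)
    (hmem : ∀ j, t j ∈ Set.Ioo (-1 : ℝ) 1)
    (hroot : ∀ j, (legendre (N + 1)).eval (t j) = 0)
    (w : Fin (N + 1) → ℝ)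
    (hw : ∀ j, w j = ∫ s in (-1 : ℝ)..1, (Lagrange.basis Finset.univ t j).eval s) :
    ∀ p : Polynomial ℝ, p.degree ≤ (2 * N + 1 : ℕ) →
      ∑ j : Fin (N + 1), w j * p.eval (t j) = ∫ s in (-1 : ℝ)..1, p.eval s := by
  intro p hp
  have hL : (legendre (N + 1)).natDegree = N + 1 := natDegree_legendre _
  have hL0 : legendre (N + 1) ≠ 0 := by
    intro h
    simp [h] at hL
  have hdeg : (legendre (N + 1)).degree = (N + 1 : ℕ) := by rw [degree_eq_natDegree hL0, hL]
  have hmod : (p % legendre (N + 1)).degree < (N + 1 : ℕ) :=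
    hdeg ▸ EuclideanDomain.mod_lt p hL0
  have hdiv : (p / legendre (N + 1)).degree < (N + 1 : ℕ) := by
    rcases lt_or_ge p.degree (legendre (N + 1)).degree with h | h
    · rw [(Polynomial.div_eq_zero_iff hL0).2 h, degree_zero]
      exact WithBot.bot_lt_coe _
    · have hsum := degree_add_div hL0 h
      by_contra! hge
      have hle : ((N + 1 : ℕ) : WithBot ℕ) + (N + 1 : ℕ) ≤ (2 * N + 1 : ℕ) :=
        (add_le_add hdeg.ge hge).trans (hsum.trans_le hp)
      have : N + 1 + (N + 1) ≤ 2 * N + 1 := by exact_mod_cast hle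
      omega
  have hsplit : ∀ s, p.eval s =
      (legendre (N + 1) * (p / legendre (N + 1))).eval s + (p % legendre (N + 1)).eval s := by
    intro s
    rw [← eval_add, EuclideanDomain.div_add_mod]
  have hnode : ∀ j, p.eval (t j) = (p % legendre (N + 1)).eval (t j) := by
    intro j
    rw [hsplit, eval_mul, hroot, zero_mul, zero_add]
  simp only [hw, hnode]
  rw [sum_integral_basis_mul_eval hinj hmod]
  conv_rhs => simp only [hsplit]
  rw [intervalIntegral.integral_add (Continuous.intervalIntegrable (by fun_prop) _ _)
    (Continuous.intervalIntegrable (by fun_prop) _ _), integral_legendre_mul hdiv, zero_add]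
end

section
/- For every feasible solution (x₁, x₂, u) of Problem E2, the cost satisfies the identity ∫₀¹ x₂(t) u(t) dt = (x₂(1)² − x₂(0)²)/2 + ∫₀¹ x₂(t)² dt = ∫₀¹ x₂(t)² dt, where the last equality uses the boundary conditions x₂(0) = x₂(1) = 1. -/
/-- A feasible triple `(x₁, x₂, u)` of Problem `E2`: `x₁, x₂` are continuously
differentiable, `u` is continuous, `ẋ₁ = x₂`, `ẋ₂ = −x₂ + u`, `0 ≤ u ≤ 2`, `x₂ ≥ 0` on
`[0, 1]`, with boundary conditions `(x₁(0), x₂(0)) = (0, 1)` and `(x₁(1), x₂(1)) = (1, 1)`. -/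
def FeasibleE2 (x₁ x₂ u : ℝ → ℝ) : Prop :=
  ContDiffOn ℝ 1 x₁ (Set.Icc (0 : ℝ) 1) ∧ ContDiffOn ℝ 1 x₂ (Set.Icc (0 : ℝ) 1) ∧
  ContinuousOn u (Set.Icc (0 : ℝ) 1) ∧
  (∀ t ∈ Set.Icc (0 : ℝ) 1, HasDerivWithinAt x₁ (x₂ t) (Set.Icc (0 : ℝ) 1) t) ∧
  (∀ t ∈ Set.Icc (0 : ℝ) 1, HasDerivWithinAt x₂ (-x₂ t + u t) (Set.Icc (0 : ℝ) 1) t) ∧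
  (∀ t ∈ Set.Icc (0 : ℝ) 1, 0 ≤ u t ∧ u t ≤ 2) ∧
  (∀ t ∈ Set.Icc (0 : ℝ) 1, 0 ≤ x₂ t) ∧
  x₁ 0 = 0 ∧ x₂ 0 = 1 ∧ x₁ 1 = 1 ∧ x₂ 1 = 1

/-- Energy identity for `ẋ = −x + u` on `[a, b]`: multiplying the equation by `x` and integrating
gives `∫ x u = (x(b)² − x(a)²)/2 + ∫ x²`. -/
theorem integral_mul_eq_of_hasDerivWithinAt_neg_add {a b : ℝ} (hab : a ≤ b) {x u : ℝ → ℝ}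
    (hu : ContinuousOn u (Set.Icc a b))
    (hx : ∀ t ∈ Set.Icc a b, HasDerivWithinAt x (-x t + u t) (Set.Icc a b) t) :
    ∫ t in a..b, x t * u t = (x b ^ 2 - x a ^ 2) / 2 + ∫ t in a..b, x t ^ 2 := by
  have hxc : ContinuousOn x (Set.Icc a b) := fun t ht => (hx t ht).continuousWithinAt
  have hxu : IntervalIntegrable (fun t => x t * u t) MeasureTheory.volume a b :=
    (hxc.mul hu).intervalIntegrable_of_Icc hab
  have hxx : IntervalIntegrable (fun t => x t ^ 2) MeasureTheory.volume a b :=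
    (hxc.pow 2).intervalIntegrable_of_Icc hab
  have hderiv : ∀ t ∈ Set.Ioo a b,
      HasDerivAt (fun s => x s ^ 2 / 2) (x t * u t - x t ^ 2) t := fun t ht => by
    have h := (hx t (Set.Ioo_subset_Icc_self ht)).hasDerivAt (Icc_mem_nhds ht.1 ht.2)
    refine ((h.fun_pow 2).div_const 2).congr_deriv ?_
    push_cast
    ring
  have hint := intervalIntegral.integral_eq_sub_of_hasDerivAt_of_le hab
    ((hxc.pow 2).div_const 2) hderiv (hxu.sub hxx)
  rw [intervalIntegral.integral_sub hxu hxx] at hint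
  simp only [Pi.pow_apply] at hint
  linarith

/-- For every feasible solution of Problem `E2`, the cost satisfies
`∫₀¹ x₂ u dt = (x₂(1)² − x₂(0)²)/2 + ∫₀¹ x₂² dt = ∫₀¹ x₂² dt`, the last equality using the
boundary conditions `x₂(0) = x₂(1) = 1`. -/
theorem E2_cost_identity (x₁ x₂ u : ℝ → ℝ) (hfeas : FeasibleE2 x₁ x₂ u) :
    (∫ t in (0 : ℝ)..1, x₂ t * u t) =
      (x₂ 1 ^ 2 - x₂ 0 ^ 2) / 2 + ∫ t in (0 : ℝ)..1, (x₂ t) ^ 2 ∧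
    (∫ t in (0 : ℝ)..1, x₂ t * u t) = ∫ t in (0 : ℝ)..1, (x₂ t) ^ 2 := by
  obtain ⟨-, -, hu, -, hx₂, -, -, -, h0, -, h1⟩ := hfeas
  have hcost := integral_mul_eq_of_hasDerivWithinAt_neg_add zero_le_one hu hx₂
  refine ⟨hcost, ?_⟩
  rw [hcost, h0, h1]
  ring
end

section
/- Every feasible solution of Problem E2 has cost J = ∫₀¹ x₂(t) u(t) dt ≥ 1; the triple x₁*(t) = t, x₂*(t) = 1, u*(t) = 1 is feasible for Problem E2 and attains J = 1; and any feasible solution attaining J = 1 satisfies x₂(t) = 1 and u(t) = 1 for all t ∈ [0, 1]. Hence (x₁*, x₂*, u*) = (t, 1, 1) is the unique optimal solution of Problem E2, with optimal cost 1. -/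
open Set

/-- The cost of a feasible solution exceeds `1` by the squared `L²` distance from `x₂` to `1`. -/
theorem FeasibleE2.cost_eq {x₁ x₂ u : ℝ → ℝ} (h : FeasibleE2 x₁ x₂ u) :
    ∫ t in (0 : ℝ)..1, x₂ t * u t = 1 + ∫ t in (0 : ℝ)..1, (x₂ t - 1) ^ 2 := by
  obtain ⟨h₁, h₂, hu, hd₁, hd₂, -, -, h₁0, h₂0, h₁1, h₂1⟩ := h
  have hxu : ContinuousOn (fun t => x₂ t * u t) (Icc 0 1) := h₂.continuousOn.mul hu
  have hsq : ContinuousOn (fun t => (x₂ t - 1) ^ 2) (Icc 0 1) :=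
    (h₂.continuousOn.sub continuousOn_const).pow 2
  have hderiv : ∀ t ∈ Ioo (0 : ℝ) 1,
      HasDerivAt (fun t => x₂ t ^ 2 / 2 + 2 * x₁ t - t) (x₂ t * u t - (x₂ t - 1) ^ 2) t := by
    intro t ht
    have hn := Icc_mem_nhds ht.1 ht.2
    have d₁ := (hd₁ t (Ioo_subset_Icc_self ht)).hasDerivAt hn
    have d₂ := (hd₂ t (Ioo_subset_Icc_self ht)).hasDerivAt hn
    refine ((((d₂.pow 2).div_const 2).add (d₁.const_mul 2)).sub (hasDerivAt_id t)).congr_deriv ?_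
    norm_num
    ring
  have hcont : ContinuousOn (fun t => x₂ t ^ 2 / 2 + 2 * x₁ t - t) (Icc 0 1) :=
    (((h₂.continuousOn.pow 2).div_const 2).add (continuousOn_const.mul h₁.continuousOn)).sub
      continuousOn_id
  have ixu := hxu.intervalIntegrable_of_Icc (μ := MeasureTheory.volume) zero_le_one
  have isq := hsq.intervalIntegrable_of_Icc (μ := MeasureTheory.volume) zero_le_one
  have key := intervalIntegral.integral_eq_sub_of_hasDerivAt_of_le zero_le_one hcont hderiv
    (ixu.sub isq)
  rw [intervalIntegral.integral_sub ixu isq, h₁0, h₂0, h₁1, h₂1] at key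
  linarith

/-- Every feasible solution of Problem `E2` has cost `J = ∫₀¹ x₂ u dt ≥ 1`; the triple
`x₁*(t) = t`, `x₂*(t) = 1`, `u*(t) = 1` is feasible and attains `J = 1`; and any feasible
solution attaining `J = 1` satisfies `x₂(t) = 1` and `u(t) = 1` for all `t ∈ [0, 1]`.
Hence `(x₁*, x₂*, u*) = (t, 1, 1)` is the unique optimal solution of `E2`, with optimal
cost `1`. -/
theorem E2_optimal_solution :
    (∀ x₁ x₂ u : ℝ → ℝ, FeasibleE2 x₁ x₂ u → 1 ≤ ∫ t in (0 : ℝ)..1, x₂ t * u t) ∧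
    (FeasibleE2 (fun t => t) (fun _ => 1) (fun _ => 1) ∧
      (∫ t in (0 : ℝ)..1, (fun _ : ℝ => (1 : ℝ)) t * (fun _ : ℝ => (1 : ℝ)) t) = 1) ∧
    (∀ x₁ x₂ u : ℝ → ℝ, FeasibleE2 x₁ x₂ u →
      (∫ t in (0 : ℝ)..1, x₂ t * u t) = 1 →
      ∀ t ∈ Set.Icc (0 : ℝ) 1, x₂ t = 1 ∧ u t = 1) := by
  refine ⟨fun x₁ x₂ u h => ?_, ⟨⟨contDiffOn_id, contDiffOn_const, continuousOn_const,
    fun t _ => hasDerivWithinAt_id t _, fun t _ => ?_, fun t _ => by norm_num,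
    fun t _ => zero_le_one, rfl, rfl, rfl, rfl⟩, by simp⟩, fun x₁ x₂ u h hJ => ?_⟩
  · rw [h.cost_eq]
    exact le_add_of_nonneg_right
      (intervalIntegral.integral_nonneg zero_le_one fun t _ => sq_nonneg _)
  · simpa using hasDerivWithinAt_const t (Icc (0 : ℝ) 1) (1 : ℝ)
  · have hzero : ∫ t in (0 : ℝ)..1, (x₂ t - 1) ^ 2 = 0 := by
      linarith [h.cost_eq]
    obtain ⟨-, h₂, -, -, hd₂, -⟩ := h
    have hx : ∀ t ∈ Icc (0 : ℝ) 1, x₂ t = 1 := by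
      intro t ht
      by_contra hne
      exact (intervalIntegral.integral_pos zero_lt_one
        ((h₂.continuousOn.sub continuousOn_const).pow 2) (fun s _ => sq_nonneg _)
        ⟨t, ht, sq_pos_of_ne_zero (sub_ne_zero.mpr hne)⟩).ne' hzero
    intro t ht
    have hconst : HasDerivWithinAt x₂ 0 (Icc 0 1) t :=
      (hasDerivWithinAt_const t (Icc (0 : ℝ) 1) (1 : ℝ)).congr hx (hx t ht)
    have hu := (uniqueDiffOn_Icc zero_lt_one t ht).eq_deriv _ (hd₂ t ht) hconst
    exact ⟨hx t ht, by linarith [hx t ht]⟩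
end
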